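/- arXiv:2408.01798 — 4 statements merged into one kernel-verified Lean document; each statement's English description precedes it below -/
import Mathlib

section
/- Uncrossing an isolating cut with a minimum cut: Let (V, w) be a weighted graph, let R ⊆ V, and let v, s ∈ R be distinct. Let S* ⊆ V satisfy v ∈ S*, s ∉ S*, and w(S*) = λ(v, s) (i.e., S* is the v-side of a minimum v-s cut). Then for every S ⊆ V with S ∩ R = {v}, the set S ∩ S* satisfies (S ∩ S*) ∩ R = {v} and w(S ∩ S*) ≤ w(S). -/
open Finset

/-- Cut value of a set `S` in a weighted graph on a finite vertex type `V`. -/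
def cutVal {V : Type*} [Fintype V] [DecidableEq V] (w : V → V → ℝ) (S : Finset V) : ℝ :=
  ∑ u ∈ S, ∑ v ∈ Sᶜ, w u v

/-- Minimum `s`-`t` cut value: the infimum of cut values over sets containing `s`
but not `t`. -/
noncomputable def minCut {V : Type*} [Fintype V] [DecidableEq V] (w : V → V → ℝ) (s t : V) : ℝ :=
  sInf {x : ℝ | ∃ S : Finset V, s ∈ S ∧ t ∉ S ∧ cutVal w S = x}

theorem cutVal_eq_sum_ite {V : Type*} [Fintype V] [DecidableEq V] (w : V → V → ℝ)
    (S : Finset V) :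
    cutVal w S = ∑ u, ∑ v, if u ∈ S ∧ v ∉ S then w u v else 0 := by
  have hcompl (u : V) : ∑ v ∈ Sᶜ, w u v = ∑ v, if v ∉ S then w u v else 0 := by
    rw [← sum_filter, filter_notMem_eq_sdiff, compl_eq_univ_sdiff]
  rw [cutVal, ← univ_inter S, ← sum_ite_mem]
  refine sum_congr rfl fun u _ => ?_
  by_cases hu : u ∈ S <;> simp [hu, hcompl]

/-- The cut function of a graph with nonnegative weights is submodular. -/
theorem cutVal_union_add_cutVal_inter_le {V : Type*} [Fintype V] [DecidableEq V]
    (w : V → V → ℝ) (hnonneg : ∀ u v, 0 ≤ w u v) (S T : Finset V) :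
    cutVal w (S ∪ T) + cutVal w (S ∩ T) ≤ cutVal w S + cutVal w T := by
  simp only [cutVal_eq_sum_ite, ← sum_add_distrib]
  refine sum_le_sum fun u _ => sum_le_sum fun v _ => ?_
  have := hnonneg u v
  by_cases u ∈ S <;> by_cases u ∈ T <;> by_cases v ∈ S <;> by_cases v ∈ T <;> simp [*]

theorem cutVal_nonneg {V : Type*} [Fintype V] [DecidableEq V] (w : V → V → ℝ)
    (hnonneg : ∀ u v, 0 ≤ w u v) (S : Finset V) : 0 ≤ cutVal w S :=
  sum_nonneg fun u _ => sum_nonneg fun v _ => hnonneg u v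

theorem minCut_le_cutVal {V : Type*} [Fintype V] [DecidableEq V] (w : V → V → ℝ)
    (hnonneg : ∀ u v, 0 ≤ w u v) {s t : V} {S : Finset V} (hs : s ∈ S) (ht : t ∉ S) :
    minCut w s t ≤ cutVal w S := by
  refine csInf_le ⟨0, ?_⟩ ⟨S, hs, ht, rfl⟩
  rintro _ ⟨T, -, -, rfl⟩
  exact cutVal_nonneg w hnonneg T

/-- Uncrossing an isolating cut with a minimum cut: if `S*` is the `v`-side of a
minimum `v`-`s` cut and `S` isolates `v` within `R`, then `S ∩ S*` also isolates
`v` within `R` and has no larger cut value. -/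
theorem uncross_isolating_with_min_cut {V : Type*} [Fintype V] [DecidableEq V] (w : V → V → ℝ)
    (hsymm : ∀ u v, w u v = w v u) (hnonneg : ∀ u v, 0 ≤ w u v)
    (hdiag : ∀ u, w u u = 0)
    (R : Finset V) (v s : V) (hv : v ∈ R) (hs : s ∈ R) (hvs : v ≠ s)
    (Sstar : Finset V) (hvS : v ∈ Sstar) (hsS : s ∉ Sstar)
    (hmin : cutVal w Sstar = minCut w v s)
    (S : Finset V) (hiso : S ∩ R = {v}) :
    (S ∩ Sstar) ∩ R = {v} ∧ cutVal w (S ∩ Sstar) ≤ cutVal w S := by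
  constructor
  · rw [inter_right_comm, hiso, singleton_inter_of_mem hvS]
  · have hsS' : s ∉ S := fun h =>
      hvs (mem_singleton.1 (hiso ▸ mem_inter.2 ⟨h, hs⟩)).symm
    have hunion := minCut_le_cutVal w hnonneg (s := v) (t := s) (S := S ∪ Sstar)
      (mem_union_right S hvS) (by simp [hsS, hsS'])
    linarith [cutVal_union_add_cutVal_inter_le w hnonneg S Sstar]
end

section
/- Existence of disjoint optimal isolating cuts (Fact 2.3): Let (V, w) be a weighted graph and R ⊆ V a nonempty set of terminals. For v ∈ R let μ_v = min{w(S) : S ⊆ V, S ∩ R = {v}}. Then there exists a family {S_v}_{v ∈ R} of pairwise disjoint subsets of V such that S_v ∩ R = {v} and w(S_v) = μ_v for every v ∈ R. -/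
open Finset

/-- Minimum isolating cut value of a terminal `v ∈ R`: the infimum of cut values
over sets `S` with `S ∩ R = {v}`. -/
noncomputable def minIsoCutVal {V : Type*} [Fintype V] [DecidableEq V]
    (w : V → V → ℝ) (R : Finset V) (v : V) : ℝ :=
  sInf {x : ℝ | ∃ S : Finset V, S ∩ R = {v} ∧ cutVal w S = x}

/-- Twice the cut value counts every ordered pair separated by `S`. -/
theorem two_mul_cutVal {V : Type*} [Fintype V] [DecidableEq V] {w : V → V → ℝ}
    (hsymm : ∀ u v, w u v = w v u) (S : Finset V) :
    2 * cutVal w S = ∑ u, ∑ v, if (u ∈ S ↔ v ∈ S) then 0 else w u v := by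
  have h₁ : cutVal w S = ∑ u, ∑ v, if u ∈ S ∧ v ∉ S then w u v else 0 := by
    have h (u : V) : ∑ v ∈ Sᶜ, w u v = ∑ v, if v ∈ Sᶜ then w u v else 0 := by
      rw [Finset.sum_ite_mem, Finset.univ_inter]
    simp [cutVal, h, ite_and]
  have h₂ : cutVal w S = ∑ u, ∑ v, if v ∈ S ∧ u ∉ S then w u v else 0 := by
    rw [h₁, Finset.sum_comm]
    simp only [hsymm]
  rw [two_mul]
  nth_rewrite 1 [h₁]
  rw [h₂]
  simp only [← Finset.sum_add_distrib]
  refine Finset.sum_congr rfl fun u _ => Finset.sum_congr rfl fun v _ => ?_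
  by_cases hu : u ∈ S <;> by_cases hv : v ∈ S <;> simp [hu, hv]

/-- Posimodularity of the cut function. -/
theorem cutVal_sdiff_add_cutVal_sdiff_le {V : Type*} [Fintype V] [DecidableEq V]
    {w : V → V → ℝ} (hsymm : ∀ u v, w u v = w v u) (hnonneg : ∀ u v, 0 ≤ w u v)
    (A B : Finset V) :
    cutVal w (A \ B) + cutVal w (B \ A) ≤ cutVal w A + cutVal w B := by
  suffices h : 2 * cutVal w (A \ B) + 2 * cutVal w (B \ A) ≤
      2 * cutVal w A + 2 * cutVal w B by linarith
  simp only [two_mul_cutVal hsymm, ← Finset.sum_add_distrib]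
  refine Finset.sum_le_sum fun u _ => Finset.sum_le_sum fun v _ => ?_
  have := hnonneg u v
  by_cases hua : u ∈ A <;> by_cases hub : u ∈ B <;> by_cases hva : v ∈ A <;>
    by_cases hvb : v ∈ B <;> simp [hua, hub, hva, hvb, this]

theorem minIsoCutVal_le {V : Type*} [Fintype V] [DecidableEq V] (w : V → V → ℝ)
    {R S : Finset V} {v : V} (hS : S ∩ R = {v}) : minIsoCutVal w R v ≤ cutVal w S :=
  csInf_le ((Set.finite_range (cutVal w)).subset
    (by rintro _ ⟨T, -, rfl⟩; exact ⟨T, rfl⟩)).bddBelow ⟨S, hS, rfl⟩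

/-- The minimum isolating cut value is attained by some set of least cardinality. -/
theorem exists_card_le_of_cutVal_eq_minIsoCutVal {V : Type*} [Fintype V] [DecidableEq V]
    (w : V → V → ℝ) {R : Finset V} {v : V} (hv : v ∈ R) :
    ∃ S : Finset V, S ∩ R = {v} ∧ cutVal w S = minIsoCutVal w R v ∧
      ∀ T : Finset V, T ∩ R = {v} → cutVal w T = minIsoCutVal w R v → #S ≤ #T := by
  have hmem : minIsoCutVal w R v ∈
      {x : ℝ | ∃ S : Finset V, S ∩ R = {v} ∧ cutVal w S = x} :=
    Set.Nonempty.csInf_mem ⟨_, {v}, by simpa using hv, rfl⟩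
      ((Set.finite_range (cutVal w)).subset (by rintro _ ⟨T, -, rfl⟩; exact ⟨T, rfl⟩))
  obtain ⟨S₀, hS₀⟩ := hmem
  obtain ⟨S, hS, hmin⟩ := Finset.exists_min_image
    ({S : Finset V | S ∩ R = {v} ∧ cutVal w S = minIsoCutVal w R v} : Finset (Finset V))
    Finset.card ⟨S₀, by simpa using hS₀⟩
  simp only [Finset.mem_filter, Finset.mem_univ, true_and] at hS hmin
  exact ⟨S, hS.1, hS.2, fun T h₁ h₂ => hmin T ⟨h₁, h₂⟩⟩

theorem sdiff_inter_eq_singleton {V : Type*} [DecidableEq V] {A B R : Finset V} {u v : V}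
    (hA : A ∩ R = {v}) (hB : B ∩ R = {u}) (hne : v ≠ u) : (A \ B) ∩ R = {v} := by
  rw [Finset.sdiff_inter_right_comm, hA, Finset.sdiff_eq_self_iff_disjoint,
    Finset.disjoint_singleton_left]
  intro hvB
  have hvR : v ∈ R := (Finset.mem_inter.1 (hA ▸ Finset.mem_singleton_self v)).2
  exact hne (Finset.mem_singleton.1 (hB ▸ Finset.mem_inter.2 ⟨hvB, hvR⟩))

/-- Existence of disjoint optimal isolating cuts: there is a family of pairwise
disjoint sets, one per terminal, each isolating its terminal with minimum cut value. -/
theorem exists_disjoint_min_isolating_cuts {V : Type*} [Fintype V] [DecidableEq V]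
    (w : V → V → ℝ)
    (hsymm : ∀ u v, w u v = w v u) (hnonneg : ∀ u v, 0 ≤ w u v)
    (hdiag : ∀ u, w u u = 0)
    (R : Finset V) (hR : R.Nonempty) :
    ∃ S : V → Finset V,
      (∀ v ∈ R, (S v) ∩ R = {v}) ∧
      (∀ v ∈ R, cutVal w (S v) = minIsoCutVal w R v) ∧
      (∀ v ∈ R, ∀ u ∈ R, v ≠ u → Disjoint (S v) (S u)) := by
  choose! S hS hcut hcard using
    fun v (hv : v ∈ R) => exists_card_le_of_cutVal_eq_minIsoCutVal w hv
  refine ⟨S, hS, hcut, fun v hv u hu hne => ?_⟩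
  have hvu := sdiff_inter_eq_singleton (hS v hv) (hS u hu) hne
  have huv := sdiff_inter_eq_singleton (hS u hu) (hS v hv) hne.symm
  have hpos := cutVal_sdiff_add_cutVal_sdiff_le hsymm hnonneg (S v) (S u)
  have hle_v := minIsoCutVal_le w hvu
  have hle_u := minIsoCutVal_le w huv
  rw [hcut v hv, hcut u hu] at hpos
  have hle := hcard v hv _ hvu (by linarith)
  exact Finset.sdiff_eq_self_iff_disjoint.1
    (Finset.eq_of_subset_of_card_le Finset.sdiff_subset hle)
end

section
/- Aggregate uncrossing of isolating pieces with an approximately minimum separator (deterministic core of Claim 3.2): Let (V, w) be a weighted graph, let A, B ⊆ V be disjoint nonempty sets, and let λ(A,B) = min{w(X) : X ⊆ V, A ⊆ X, X ∩ B = ∅}. Let C ⊆ V satisfy A ⊆ C, C ∩ B = ∅, and w(C) ≤ λ(A,B) + Δ for a real Δ ≥ 0. Let {T_r}_{r ∈ A} be pairwise disjoint subsets of V with r ∈ T_r and T_r ∩ B = ∅ for every r ∈ A. Then Σ_{r ∈ A} w(T_r ∩ C) ≤ Σ_{r ∈ A} w(T_r) + Δ. -/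
open Finset

/-- Minimum `A`-`B` cut value: the infimum of cut values over sets containing `A`
and disjoint from `B`. -/
noncomputable def minCutSets {V : Type*} [Fintype V] [DecidableEq V]
    (w : V → V → ℝ) (A B : Finset V) : ℝ :=
  sInf {x : ℝ | ∃ X : Finset V, A ⊆ X ∧ X ∩ B = ∅ ∧ cutVal w X = x}

/-- The cut function of a nonnegatively weighted graph is submodular. -/
theorem cutVal_inter_add_cutVal_union_le {V : Type*} [Fintype V] [DecidableEq V]
    {w : V → V → ℝ} (hnonneg : ∀ u v, 0 ≤ w u v) (S T : Finset V) :
    cutVal w (S ∩ T) + cutVal w (S ∪ T) ≤ cutVal w S + cutVal w T := by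
  have cutVal_eq (R : Finset V) :
      cutVal w R = ∑ u, ∑ v, if u ∈ R ∧ v ∉ R then w u v else 0 := by
    simp only [cutVal, ite_and, ← mem_compl, sum_ite_irrel, sum_const_zero,
      sum_ite_mem, univ_inter]
  simp only [cutVal_eq, ← sum_add_distrib]
  refine sum_le_sum fun u _ => sum_le_sum fun v _ => ?_
  have := hnonneg u v
  by_cases hu : u ∈ S <;> by_cases hu' : u ∈ T <;> by_cases hv : v ∈ S <;>
    by_cases hv' : v ∈ T <;> simp [*]

/-- Uncrossing a set `C` successively with the members of a pairwise disjoint family. -/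
theorem sum_cutVal_inter_add_cutVal_union_biUnion_le {V ι : Type*} [Fintype V] [DecidableEq V]
    {w : V → V → ℝ} (hnonneg : ∀ u v, 0 ≤ w u v) (C : Finset V) (T : ι → Finset V)
    (s : Finset ι) (hdisj : (s : Set ι).PairwiseDisjoint T) :
    ∑ r ∈ s, cutVal w (T r ∩ C) + cutVal w (C ∪ s.biUnion T) ≤
      ∑ r ∈ s, cutVal w (T r) + cutVal w C := by
  classical
  induction s using Finset.induction_on with
  | empty => simp
  | insert a s ha ih =>
    have ih := ih (hdisj.subset (by simp))
    have hdisj_a : Disjoint (T a) (s.biUnion T) :=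
      (disjoint_biUnion_right _ _ _).2 fun r hr =>
        hdisj (by simp) (by simp [hr]) (ne_of_mem_of_not_mem hr ha).symm
    have hinter : T a ∩ (C ∪ s.biUnion T) = T a ∩ C := by
      rw [inter_union_distrib_left, disjoint_iff_inter_eq_empty.1 hdisj_a, union_empty]
    have hunion : T a ∪ (C ∪ s.biUnion T) = C ∪ (insert a s).biUnion T := by
      rw [biUnion_insert, union_left_comm]
    have hsub := cutVal_inter_add_cutVal_union_le hnonneg (T a) (C ∪ s.biUnion T)
    rw [hinter, hunion] at hsub
    rw [sum_insert ha, sum_insert ha]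
    linarith

/-- The minimum cut value is at most the cut value of any separating set. -/
theorem minCutSets_le_cutVal {V : Type*} [Fintype V] [DecidableEq V] (w : V → V → ℝ)
    {A B X : Finset V} (hA : A ⊆ X) (hB : X ∩ B = ∅) : minCutSets w A B ≤ cutVal w X :=
  csInf_le ((Set.finite_range (cutVal w)).subset
    (by rintro _ ⟨Y, -, -, rfl⟩; exact ⟨Y, rfl⟩)).bddBelow ⟨X, hA, hB, rfl⟩

/-- Aggregate uncrossing of isolating pieces with an approximately minimum
separator: if `C` is a `Δ`-approximate minimum `A`-`B` cut and the `T_r` are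
pairwise disjoint `B`-avoiding sets with `r ∈ T_r`, then
`Σ_{r ∈ A} w(T_r ∩ C) ≤ Σ_{r ∈ A} w(T_r) + Δ`. -/
theorem aggregate_uncrossing {V : Type*} [Fintype V] [DecidableEq V] (w : V → V → ℝ)
    (hsymm : ∀ u v, w u v = w v u) (hnonneg : ∀ u v, 0 ≤ w u v)
    (hdiag : ∀ u, w u u = 0)
    (A B : Finset V) (hAB : Disjoint A B) (hA : A.Nonempty) (hB : B.Nonempty)
    (C : Finset V) (hAC : A ⊆ C) (hCB : C ∩ B = ∅)
    (Δ : ℝ) (hΔ : 0 ≤ Δ) (hC : cutVal w C ≤ minCutSets w A B + Δ)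
    (T : V → Finset V)
    (hdisj : ∀ r ∈ A, ∀ r' ∈ A, r ≠ r' → Disjoint (T r) (T r'))
    (hmem : ∀ r ∈ A, r ∈ T r)
    (hTB : ∀ r ∈ A, T r ∩ B = ∅) :
    ∑ r ∈ A, cutVal w (T r ∩ C) ≤ (∑ r ∈ A, cutVal w (T r)) + Δ := by
  have huncross := sum_cutVal_inter_add_cutVal_union_biUnion_le hnonneg C T A
    fun r hr r' hr' hne => hdisj r hr r' hr' hne
  have hmin : minCutSets w A B ≤ cutVal w (C ∪ A.biUnion T) := by
    refine minCutSets_le_cutVal w (hAC.trans subset_union_left) ?_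
    simp only [← disjoint_iff_inter_eq_empty] at hCB hTB ⊢
    exact disjoint_union_left.2 ⟨hCB, (disjoint_biUnion_left _ _ _).2 hTB⟩
  linarith
end

section
/- Tree edges leaving the parts of a partition (used in the proof of Corollary 1.4): Let T be a tree on a finite vertex set V and let V_1, …, V_k (k ≥ 1) be a partition of V into nonempty pairwise disjoint parts with union V. Then there exist an index j ∈ {1, …, k} and an injective assignment that maps each index i ∈ {1, …, k} ∖ {j} to an edge e_i of T such that e_i has exactly one endpoint in V_i. -/
/-- The image of a connected graph under a surjective map is connected, even when the map
collapses edges. -/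
theorem SimpleGraph.Connected.map_of_surjective {V W : Type*} {G : SimpleGraph V}
    (hG : G.Connected) {f : V → W} (hf : Function.Surjective f) : (G.map f).Connected := by
  have reachable_of_walk {u v : V} (p : G.Walk u v) : (G.map f).Reachable (f u) (f v) := by
    induction p with
    | nil => exact .rfl
    | @cons u v w huv _ ih =>
      by_cases h : f u = f v
      · rwa [h]
      · have hadj : (G.map f).Adj (f u) (f v) := ⟨h, u, v, huv, rfl, rfl⟩
        exact hadj.reachable.trans ih
  have := hG.nonempty.map f
  refine ⟨fun a b => ?_⟩
  obtain ⟨u, rfl⟩ := hf a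
  obtain ⟨v, rfl⟩ := hf b
  exact (hG.preconnected u v).elim reachable_of_walk

/-- In a connected graph, every vertex other than `v` has a neighbour closer to `v`. -/
theorem SimpleGraph.Connected.exists_adj_dist_lt {V : Type*} {G : SimpleGraph V}
    (hG : G.Connected) {u v : V} (huv : u ≠ v) : ∃ w, G.Adj u w ∧ G.dist w v < G.dist u v := by
  obtain ⟨p, hp⟩ := hG.exists_walk_length_eq_dist u v
  cases p with
  | nil => exact absurd rfl huv
  | @cons _ w _ huw q =>
    have := SimpleGraph.dist_le q
    rw [SimpleGraph.Walk.length_cons] at hp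
    exact ⟨w, huw, by lia⟩


/-- Tree edges leaving the parts of a partition: for any tree `G` on `V` and any
partition `V_1, …, V_k` of `V`, there is an index `j` and an injective assignment
of distinct tree edges `e_i` to the indices `i ≠ j` such that `e_i` has exactly
one endpoint in `V_i`. -/
theorem tree_edges_leaving_parts {V : Type*} [Fintype V] [DecidableEq V]
    (G : SimpleGraph V) (hG : G.IsTree)
    (k : ℕ) (hk : 1 ≤ k) (P : Fin k → Finset V)
    (hne : ∀ i, (P i).Nonempty)
    (hdisj : ∀ i j, i ≠ j → Disjoint (P i) (P j))
    (hcover : Finset.univ.biUnion P = Finset.univ) :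
    ∃ j : Fin k, ∃ e : Fin k → Sym2 V,
      Set.InjOn e {i | i ≠ j} ∧
      ∀ i, i ≠ j → e i ∈ G.edgeSet ∧
        ∃ u v : V, e i = s(u, v) ∧ u ∈ P i ∧ v ∉ P i := by
  have hmem (x : V) : ∃ i, x ∈ P i := by
    simpa using hcover.ge (Finset.mem_univ x)
  choose part hpart using hmem
  have part_eq {x : V} {i : Fin k} (hx : x ∈ P i) : part x = i := by
    by_contra h
    exact Finset.disjoint_left.mp (hdisj _ _ h) (hpart x) hx
  have hsurj : Function.Surjective part := fun i => (hne i).imp fun _ => part_eq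
  have hQ := hG.connected.map_of_surjective hsurj
  let j : Fin k := ⟨0, hk⟩
  have exists_edge (i : Fin k) (hi : i ≠ j) : ∃ u v : V, G.Adj u v ∧ part u = i ∧
      (G.map part).dist (part v) j < (G.map part).dist (part u) j := by
    obtain ⟨_, ⟨_, u, v, huv, rfl, rfl⟩, hlt⟩ := hQ.exists_adj_dist_lt hi
    exact ⟨u, v, huv, rfl, hlt⟩
  have := hG.connected.nonempty
  choose! u v hadj hu hlt using exists_edge
  refine ⟨j, fun i => s(u i, v i), ?_, fun i hi => ⟨hadj i hi, u i, v i, rfl, ?_, ?_⟩⟩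
  · intro a ha b hb hab
    rcases Sym2.eq_iff.mp hab with ⟨h, -⟩ | ⟨h₁, h₂⟩
    · rw [← hu a ha, h, hu b hb]
    · have hlt_a := hlt a ha
      have hlt_b := hlt b hb
      rw [h₁, h₂] at hlt_a
      exact absurd hlt_a hlt_b.asymm
  · simpa only [hu i hi] using hpart (u i)
  · intro hv
    have hlt_i := hlt i hi
    rw [part_eq hv, hu i hi] at hlt_i
    exact hlt_i.false
end
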